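/- Let p ≥ 2 be an integer and Q(X,Y) = A X² + B X Y + C Y² an integral binary quadratic form which is indefinite with non-square discriminant D_Q, and with A ≡ 1 mod p. Let D' be the quotient of D_Q by the square of the gcd of the coefficients of Q, let (t_{Q,p}, u_{Q,p}) be the solution of t² − D' u² = 4 with t_{Q,p}, u_{Q,p} > 0, p | u_{Q,p} and u_{Q,p} minimal, and R_{Q,p} = log((t_{Q,p} + u_{Q,p}√D')/2). Let 𝒫₀(p) be the set of coprime pairs (X,Y) ∈ ℤ² with Y ≡ 0 mod p, and let Ψ_{Q,p,0}(s) be the number of orbits of SO(Q,ℤ) ∩ Γ₀(p) on {(X,Y) ∈ 𝒫₀(p) : |Q(X,Y)| ≤ s}, where Γ₀(p) denotes the set of γ = (a,b;c,d) ∈ SL₂(ℤ) with c ≡ 0 mod p. Then, as s → +∞, Ψ_{Q,p,0}(s) ∼ (12 R_{Q,p} / (π² p √D_Q)) · (∏_{𝔭 prime, 𝔭 | p} (1 + 1/𝔭))^{−1} · s. -/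

import Mathlib

open scoped Real

abbrev SL2Z := Matrix.SpecialLinearGroup (Fin 2) ℤ

/-- The value `Q(x, y) = A x² + B x y + C y²`. -/
def Qval (A B C : ℤ) (x : ℤ × ℤ) : ℤ := A * x.1 ^ 2 + B * x.1 * x.2 + C * x.2 ^ 2

/-- The linear action of `SL(2,ℤ)` on `ℤ²`. -/
def actPair (g : SL2Z) (x : ℤ × ℤ) : ℤ × ℤ :=
  (g.1 0 0 * x.1 + g.1 0 1 * x.2, g.1 1 0 * x.1 + g.1 1 1 * x.2)

/-- The right action of `SL(2,ℤ)` on binary quadratic forms on coefficients;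
`SO(Q, ℤ) = {γ ∈ SL₂(ℤ) : Q ∘ γ = Q}`. -/
def formComp (A B C : ℤ) (g : SL2Z) : ℤ × ℤ × ℤ :=
  (A * (g.1 0 0) ^ 2 + B * (g.1 0 0) * (g.1 1 0) + C * (g.1 1 0) ^ 2,
   2 * A * (g.1 0 0) * (g.1 0 1) + B * ((g.1 0 0) * (g.1 1 1) + (g.1 0 1) * (g.1 1 0))
     + 2 * C * (g.1 1 0) * (g.1 1 1),
   A * (g.1 0 1) ^ 2 + B * (g.1 0 1) * (g.1 1 1) + C * (g.1 1 1) ^ 2)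

/-- `Ψ_{Q,p,0}(s)`: the number of orbits of `SO(Q,ℤ) ∩ Γ₀(p)` (where `Γ₀(p)` is the set of
`(a, b; c, d) ∈ SL₂(ℤ)` with `c ≡ 0 mod p`) on the set `𝒫₀(p)` of pairs of coprime integers
`(X, Y)` with `Y ≡ 0 mod p` and `|Q(X, Y)| ≤ s`. -/
noncomputable def PsiP0 (p : ℕ) (A B C : ℤ) (s : ℝ) : ℕ :=
  Nat.card (Quot (fun x y :
      {x : ℤ × ℤ // IsCoprime x.1 x.2 ∧ (p : ℤ) ∣ x.2 ∧
        ((|Qval A B C x| : ℤ) : ℝ) ≤ s} =>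
    ∃ g : SL2Z, formComp A B C g = (A, B, C) ∧ (p : ℤ) ∣ g.1 1 0 ∧
      (y : ℤ × ℤ) = actPair g (x : ℤ × ℤ)))

section Counting

open MeasureTheory

/-- The sector `0 < x ≤ y < ε² x`. -/
def sector (ε : ℝ) : Set (ℝ × ℝ) := {v | 0 < v.1 ∧ v.1 ≤ v.2 ∧ v.2 < ε ^ 2 * v.1}

theorem volume_graph_eq_zero {f : ℝ → ℝ} (hf : Measurable f) :
    volume {v : ℝ × ℝ | v.2 = f v.1} = 0 := by
  rw [Measure.volume_eq_prod, Measure.measure_prod_null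
    (measurableSet_eq_fun (f := fun v : ℝ × ℝ => v.2) (g := fun v => f v.1) measurable_snd
      (hf.comp measurable_fst))]
  refine Filter.Eventually.of_forall fun x => ?_
  have : Prod.mk x ⁻¹' {v : ℝ × ℝ | v.2 = f v.1} = {f x} := by ext; simp
  simp [this]

theorem integral_sector {ε : ℝ} (hε : 1 < ε) :
    IntervalIntegrable (fun x => min (ε ^ 2 * x) (1 / x)) volume 0 1 ∧
    ∫ x in (0 : ℝ)..1, min (ε ^ 2 * x) (1 / x) = 1 / 2 + Real.log ε := by
  have h0 : 0 < ε := by linarith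
  have hi : ε⁻¹ < 1 := inv_lt_one_of_one_lt₀ hε
  have hi0 : 0 < ε⁻¹ := by positivity
  have e1 : Set.EqOn (fun x : ℝ => ε ^ 2 * x) (fun x => min (ε ^ 2 * x) (1 / x))
      (Set.uIoc 0 ε⁻¹) := by
    intro x hx
    rw [Set.uIoc_of_le hi0.le] at hx
    refine (min_eq_left ?_).symm
    rw [le_div_iff₀ hx.1]
    have : ε * x ≤ 1 := by
      calc ε * x ≤ ε * ε⁻¹ := by gcongr; exact hx.2
        _ = 1 := mul_inv_cancel₀ h0.ne'
    nlinarith [mul_pos h0 hx.1]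
  have e2 : Set.EqOn (fun x : ℝ => x⁻¹) (fun x => min (ε ^ 2 * x) (1 / x))
      (Set.uIoc ε⁻¹ 1) := by
    intro x hx
    rw [Set.uIoc_of_le hi.le] at hx
    have hx0 : 0 < x := hi0.trans hx.1
    simp only [one_div]
    refine (min_eq_right ?_).symm
    rw [inv_eq_one_div, div_le_iff₀ hx0]
    have : 1 ≤ ε * x := by
      calc 1 = ε * ε⁻¹ := (mul_inv_cancel₀ h0.ne').symm
        _ ≤ ε * x := by gcongr; exact hx.1.le
    nlinarith [mul_pos h0 hx0]
  have i1 : IntervalIntegrable (fun x => min (ε ^ 2 * x) (1 / x)) volume 0 ε⁻¹ :=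
    (Continuous.intervalIntegrable (by fun_prop) _ _).congr e1
  have i2 : IntervalIntegrable (fun x => min (ε ^ 2 * x) (1 / x)) volume ε⁻¹ 1 := by
    refine (intervalIntegral.intervalIntegrable_inv (f := fun x => x) (fun x hx => ?_) ?_).congr e2
    · rw [Set.uIcc_of_le hi.le] at hx
      exact (hi0.trans_le hx.1).ne'
    · exact continuousOn_id
  refine ⟨i1.trans i2, ?_⟩
  rw [← intervalIntegral.integral_add_adjacent_intervals i1 i2,
    ← intervalIntegral.integral_congr_ae (Filter.Eventually.of_forall fun x hx => e1 hx),
    ← intervalIntegral.integral_congr_ae (Filter.Eventually.of_forall fun x hx => e2 hx),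
    intervalIntegral.integral_const_mul, integral_id, integral_inv_of_pos hi0 one_pos]
  simp
  field_simp

theorem volume_sector {ε : ℝ} (hε : 1 < ε) :
    volume.real {v ∈ sector ε | v.1 * v.2 ≤ 1} = Real.log ε := by
  have h0 : 0 < ε := by linarith
  obtain ⟨hint, hval⟩ := integral_sector hε
  have hae : ({v ∈ sector ε | v.1 * v.2 ≤ 1} : Set (ℝ × ℝ)) =ᵐ[volume]
      regionBetween (fun x => x) (fun x => min (ε ^ 2 * x) (1 / x)) (Set.Ioc 0 1) := by
    have n1 : ∀ᵐ v : ℝ × ℝ, ¬ v.2 = v.1 := by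
      rw [ae_iff]; simpa using volume_graph_eq_zero measurable_id
    have n2 : ∀ᵐ v : ℝ × ℝ, ¬ v.2 = 1 / v.1 := by
      rw [ae_iff]; simpa using volume_graph_eq_zero measurable_inv
    filter_upwards [n1, n2] with v h1 h2
    refine propext ?_
    change (_ ∧ _) ↔ (_ ∧ _)
    simp only [sector, Set.mem_ofPred_eq, Set.mem_Ioc, Set.mem_Ioo, lt_min_iff]
    constructor
    · rintro ⟨⟨a, b, c⟩, d⟩
      refine ⟨⟨a, by nlinarith⟩, lt_of_le_of_ne b (Ne.symm h1), c, lt_of_le_of_ne ?_ h2⟩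
      rw [le_div_iff₀ a]; linarith
    · rintro ⟨⟨a, b⟩, c, d, e⟩
      rw [lt_div_iff₀ a] at e
      exact ⟨⟨a, c.le, d⟩, by linarith⟩
  have hint' : IntegrableOn (fun x => min (ε ^ 2 * x) (1 / x)) (Set.Ioc 0 1) :=
    (intervalIntegrable_iff_integrableOn_Ioc_of_le zero_le_one).mp hint
  have hid : IntervalIntegrable (fun x : ℝ => x) volume 0 1 :=
    Continuous.intervalIntegrable (by fun_prop) _ _
  rw [measureReal_congr hae, measureReal_def, Measure.volume_eq_prod,
    volume_regionBetween_eq_integral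
      ((intervalIntegrable_iff_integrableOn_Ioc_of_le zero_le_one).mp hid) hint' measurableSet_Ioc,
    ← intervalIntegral.integral_of_le zero_le_one]
  · simp only [Pi.sub_apply]
    rw [intervalIntegral.integral_sub hint hid, hval, integral_id, ENNReal.toReal_ofReal]
    · norm_num
    · have := Real.log_pos hε
      norm_num
      exact this.le
  · intro x hx
    refine le_min ?_ ?_
    · nlinarith [mul_pos hx.1 (show 0 < ε ^ 2 - 1 by nlinarith)]
    · rw [le_div_iff₀ hx.1]; nlinarith [hx.1, hx.2]

theorem volume_frontier_sector (ε : ℝ) :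
    volume (frontier {v ∈ sector ε | v.1 * v.2 ≤ 1}) = 0 := by
  have hsub : frontier {v ∈ sector ε | v.1 * v.2 ≤ 1} ⊆
      (({v : ℝ × ℝ | v.1 = 0} ∪ {v | v.2 = v.1}) ∪ {v | v.2 = ε ^ 2 * v.1}) ∪
        {v | v.2 = 1 / v.1} := by
    have hs : {v ∈ sector ε | v.1 * v.2 ≤ 1} =
      (({v : ℝ × ℝ | 0 < v.1} ∩ {v | v.1 ≤ v.2}) ∩ {v | v.2 < ε ^ 2 * v.1}) ∩
        {v | v.1 * v.2 ≤ 1} := by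
      ext v; simp [sector]; tauto
    rw [hs]
    refine (frontier_inter_subset _ _).trans (Set.union_subset_union ?_ ?_)
    · refine Set.inter_subset_left.trans ?_
      refine (frontier_inter_subset _ _).trans (Set.union_subset_union ?_ ?_)
      · refine Set.inter_subset_left.trans ?_
        refine (frontier_inter_subset _ _).trans (Set.union_subset_union ?_ ?_)
        · refine Set.inter_subset_left.trans ?_
          exact (frontier_lt_subset_eq continuous_const continuous_fst).trans
            fun v hv => Eq.symm hv
        · refine Set.inter_subset_right.trans ?_
          exact (frontier_le_subset_eq continuous_fst continuous_snd).trans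
            fun v hv => Eq.symm hv
      · refine Set.inter_subset_right.trans ?_
        exact frontier_lt_subset_eq continuous_snd (by fun_prop)
    · refine Set.inter_subset_right.trans ?_
      refine (frontier_le_subset_eq (by fun_prop) continuous_const).trans fun v hv => ?_
      have hv' : v.1 * v.2 = 1 := hv
      have : v.1 ≠ 0 := left_ne_zero_of_mul_eq_one hv'
      change v.2 = 1 / v.1
      field_simp
      linarith
  refine measure_mono_null hsub ?_
  simp only [measure_union_null_iff]
  refine ⟨⟨⟨?_, volume_graph_eq_zero measurable_id⟩,
    volume_graph_eq_zero (measurable_id.const_mul _)⟩, ?_⟩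
  · have : {v : ℝ × ℝ | v.1 = 0} = {0} ×ˢ Set.univ := by ext; simp
    rw [this, Measure.volume_eq_prod, Measure.prod_prod]
    simp
  · simpa using volume_graph_eq_zero measurable_inv

theorem isBounded_sector (ε : ℝ) :
    Bornology.IsBounded {v ∈ sector ε | v.1 * v.2 ≤ 1} := by
  refine (Metric.isBounded_Icc ((0 : ℝ), (0 : ℝ)) (1, 1 + ε ^ 2)).subset ?_
  rintro ⟨x, y⟩ ⟨⟨h1, h2, h3⟩, h4⟩
  simp only at h1 h2 h3 h4
  have hx : x ≤ 1 := by nlinarith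
  have hy : y ≤ 1 + ε ^ 2 := by nlinarith [sq_nonneg ε]
  exact ⟨⟨h1.le, by linarith⟩, ⟨hx, hy⟩⟩

theorem measurableSet_sector (ε : ℝ) :
    MeasurableSet {v ∈ sector ε | v.1 * v.2 ≤ 1} := by
  refine MeasurableSet.inter (MeasurableSet.inter ?_ (MeasurableSet.inter ?_ ?_)) ?_
  · exact measurableSet_lt measurable_const measurable_fst
  · exact measurableSet_le measurable_fst measurable_snd
  · exact measurableSet_lt measurable_snd (measurable_fst.const_mul _)
  · exact measurableSet_le (measurable_fst.mul measurable_snd) measurable_const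

/-- The integral points on which two linear forms `α x + β y`, `γ x + δ y` take values in the
sector of ratio `ε²`, with product at most `s`. -/
def sectorPoints (ε α β γ δ s : ℝ) : Set (ℤ × ℤ) :=
  {x | (α * x.1 + β * x.2, γ * x.1 + δ * x.2) ∈ sector ε ∧
    (α * x.1 + β * x.2) * (γ * x.1 + δ * x.2) ≤ s}

theorem covolume_span_basisFun (ι : Type*) [Fintype ι] :
    ZLattice.covolume (Submodule.span ℤ (Set.range (Pi.basisFun ℝ ι))) = 1 := by
  classical
  rw [ZLattice.covolume_eq_measure_fundamentalDomain _ _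
    (ZSpan.isAddFundamentalDomain (Pi.basisFun ℝ ι) volume), ZSpan.volume_real_fundamentalDomain]
  have : Matrix.of (Pi.basisFun ℝ ι) = 1 := by
    ext i j
    simp [Matrix.one_apply, Pi.single_apply, eq_comm]
  simp [this]

open Filter Topology in
theorem tendsto_ncard_sectorPoints {ε : ℝ} (hε : 1 < ε) {α β γ δ : ℝ}
    (hdet : α * δ - β * γ ≠ 0) :
    Tendsto (fun s : ℝ => ((sectorPoints ε α β γ δ s).ncard : ℝ) / s) atTop
      (𝓝 (Real.log ε / |α * δ - β * γ|)) := by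
  let M : Matrix (Fin 2) (Fin 2) ℝ := !![α, β; γ, δ]
  have hM : LinearMap.det (Matrix.toLin' M) = α * δ - β * γ := by
    rw [LinearMap.det_toLin', Matrix.det_fin_two_of]
  let T : (Fin 2 → ℝ) ≃L[ℝ] (Fin 2 → ℝ) :=
    (LinearMap.equivOfDetNeZero (Matrix.toLin' M) (hM ▸ hdet)).toContinuousLinearEquiv
  let φ : (Fin 2 → ℝ) ≃L[ℝ] ℝ × ℝ := T.trans (ContinuousLinearEquiv.finTwoArrow ℝ ℝ)
  have hφ (v : Fin 2 → ℝ) : φ v = (α * v 0 + β * v 1, γ * v 0 + δ * v 1) := by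
    change (Matrix.toLin' M v 0, Matrix.toLin' M v 1) = _
    simp [M, Matrix.toLin'_apply, Matrix.mulVec, dotProduct, Fin.sum_univ_two]
  let X : Set (Fin 2 → ℝ) := φ ⁻¹' sector ε
  let F : (Fin 2 → ℝ) → ℝ := fun v => (φ v).1 * (φ v).2
  have hXF : {v ∈ X | F v ≤ 1} = φ ⁻¹' {v ∈ sector ε | v.1 * v.2 ≤ 1} := rfl
  have hvol : volume.real {v ∈ X | F v ≤ 1} = Real.log ε / |α * δ - β * γ| := by
    rw [hXF]
    have : φ ⁻¹' {v ∈ sector ε | v.1 * v.2 ≤ 1} =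
      (Matrix.toLin' M) ⁻¹' (MeasurableEquiv.finTwoArrow ⁻¹' {v ∈ sector ε | v.1 * v.2 ≤ 1}) := rfl
    rw [this, measureReal_def, Measure.addHaar_preimage_linearMap _ (hM ▸ hdet), hM,
      (volume_preserving_finTwoArrow ℝ).measure_preimage
        (measurableSet_sector ε).nullMeasurableSet, ENNReal.toReal_mul, ← measureReal_def,
      volume_sector hε, ENNReal.toReal_ofReal (abs_nonneg _), abs_inv]
    ring
  have key := ZLattice.covolume.tendsto_card_le_div
    (Submodule.span ℤ (Set.range (Pi.basisFun ℝ (Fin 2)))) (X := X) (F := F) ?_ ?_ ?_ ?_ ?_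
  · rw [covolume_span_basisFun, div_one, hvol] at key
    refine key.congr fun s => ?_
    congr 2
    rw [← Nat.card_coe_set_eq]
    symm
    refine Nat.card_congr (Equiv.ofBijective
      (fun x => ⟨![((x : ℤ × ℤ).1 : ℝ), ((x : ℤ × ℤ).2 : ℝ)], ?_⟩) ⟨?_, ?_⟩)
    · obtain ⟨x, hx⟩ := x
      refine ⟨?_, ?_⟩
      · change φ _ ∈ sector ε ∧ (φ _).1 * (φ _).2 ≤ s
        simpa [hφ, sectorPoints] using hx
      · rw [SetLike.mem_coe, Module.Basis.mem_span_iff_repr_mem]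
        intro i
        fin_cases i <;> simp
    · rintro ⟨⟨a, b⟩, ha⟩ ⟨⟨c, d⟩, hc⟩ h
      have h' := congrArg Subtype.val h
      have h0 := congrFun h' 0
      have h1 := congrFun h' 1
      simp at h0 h1
      simp [h0, h1]
    · rintro ⟨v, hv, hL⟩
      rw [SetLike.mem_coe, Module.Basis.mem_span_iff_repr_mem] at hL
      obtain ⟨a, ha⟩ := hL 0
      obtain ⟨b, hb⟩ := hL 1
      have hva : (a : ℝ) = v 0 := by simpa using ha
      have hvb : (b : ℝ) = v 1 := by simpa using hb
      refine ⟨⟨(a, b), ?_⟩, ?_⟩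
      · change φ v ∈ sector ε ∧ (φ v).1 * (φ v).2 ≤ s at hv
        rw [hφ] at hv
        simpa [sectorPoints, hva, hvb] using hv
      · refine Subtype.ext ?_
        ext i
        fin_cases i <;> simp [hva, hvb]
  · intro v r hv hr
    have hv' : φ v ∈ sector ε := hv
    change φ (r • v) ∈ sector ε
    rw [map_smul]
    obtain ⟨h1, h2, h3⟩ := hv'
    refine ⟨mul_pos hr h1, mul_le_mul_of_nonneg_left h2 hr.le, ?_⟩
    have := mul_lt_mul_of_pos_left h3 hr
    simp only [Prod.smul_fst, Prod.smul_snd, smul_eq_mul]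
    linarith
  · intro v r _
    simp only [F, map_smul, Prod.smul_fst, Prod.smul_snd, smul_eq_mul, Fintype.card_fin]
    ring
  · rw [hXF]
    exact φ.antilipschitz.isBounded_preimage (isBounded_sector ε)
  · rw [hXF]
    exact φ.continuous.measurable (measurableSet_sector ε)
  · change volume (frontier {v ∈ X | F v ≤ 1}) = 0
    rw [hXF]
    change volume (frontier (φ.toHomeomorph ⁻¹' _)) = 0
    rw [← φ.toHomeomorph.preimage_frontier]
    have : φ.toHomeomorph ⁻¹' frontier {v ∈ sector ε | v.1 * v.2 ≤ 1} =
      (Matrix.toLin' M) ⁻¹' (MeasurableEquiv.finTwoArrow ⁻¹'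
        frontier {v ∈ sector ε | v.1 * v.2 ≤ 1}) := rfl
    rw [this, Measure.addHaar_preimage_linearMap _ (hM ▸ hdet),
      (volume_preserving_finTwoArrow ℝ).measure_preimage
        isClosed_frontier.measurableSet.nullMeasurableSet, volume_frontier_sector, mul_zero]

open ArithmeticFunction ArithmeticFunction.Moebius in
theorem hasProd_moebius_gcd (p : ℕ) (hp : p ≠ 0) :
    Summable (fun d : ℕ => ‖(μ d : ℝ) * (Nat.gcd p d) / d ^ 2‖) ∧
    HasProd (fun l : Nat.Primes => 1 - (Nat.gcd p l : ℝ) / l ^ 2)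
      (∑' d : ℕ, (μ d : ℝ) * (Nat.gcd p d) / d ^ 2) := by
  set f : ℕ → ℝ := fun d => (μ d : ℝ) * (Nat.gcd p d) / d ^ 2 with hf
  have hsum : Summable (fun d => ‖f d‖) := by
    refine Summable.of_nonneg_of_le (fun _ => norm_nonneg _) (fun d => ?_)
      ((Real.summable_one_div_nat_pow.mpr one_lt_two).mul_left (p : ℝ))
    have h1 : |(μ d : ℝ)| ≤ 1 := by exact_mod_cast abs_moebius_le_one
    have h2 : (Nat.gcd p d : ℝ) ≤ p := by
      exact_mod_cast Nat.gcd_le_left _ (Nat.pos_of_ne_zero hp)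
    rw [hf]
    simp only [norm_div, norm_mul, Real.norm_eq_abs, Nat.abs_cast, abs_pow]
    rw [mul_one_div]
    gcongr
    calc |(μ d : ℝ)| * (Nat.gcd p d : ℝ) ≤ 1 * p := by gcongr
      _ = p := one_mul _
  refine ⟨hsum, ?_⟩
  have h := EulerProduct.eulerProduct_hasProd (f := f) (by simp [hf]) ?_ hsum (by simp [hf])
  · refine h.congr_fun fun l => ?_
    symm
    rw [tsum_eq_sum (s := Finset.range 2)]
    · simp [hf, Finset.sum_range_succ, moebius_apply_prime l.2]
      ring
    · intro e he
      have he2 : 2 ≤ e := by simpa [Nat.succ_le_iff] using he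
      have : μ ((l : ℕ) ^ e) = 0 := by
        rw [moebius_apply_prime_pow l.2 (by omega), if_neg (by omega)]
      simp [hf, this]
  · intro m n hmn
    simp only [hf]
    rw [isMultiplicative_moebius.map_mul_of_coprime hmn, Nat.Coprime.gcd_mul _ hmn]
    push_cast
    ring

open ArithmeticFunction ArithmeticFunction.Moebius in
theorem tsum_moebius_gcd (p : ℕ) (hp : p ≠ 0) :
    ∑' d : ℕ, (μ d : ℝ) * (Nat.gcd p d) / d ^ 2 =
      6 / π ^ 2 * (∏ l ∈ p.primeFactors, (1 + 1 / (l : ℝ)))⁻¹ := by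
  have h1 := (hasProd_moebius_gcd p hp).2
  have h2 : HasProd (fun l : Nat.Primes => (1 - 1 / (l : ℝ) ^ 2)⁻¹) (π ^ 2 / 6) := by
    let g : ℕ →*₀ ℝ :=
      { toFun := fun n => 1 / (n : ℝ) ^ 2
        map_zero' := by simp
        map_one' := by simp
        map_mul' := fun m n => by push_cast; ring }
    have := EulerProduct.eulerProduct_completely_multiplicative_hasProd (f := g)
      (Real.summable_one_div_nat_pow.mpr one_lt_two).norm
    have hz : ∑' n, g n = π ^ 2 / 6 := hasSum_zeta_two.tsum_eq
    rw [hz] at this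
    exact this
  have h3 : HasProd (fun l : Nat.Primes => if (l : ℕ) ∣ p then (1 + 1 / (l : ℝ))⁻¹ else 1)
      (∏ l ∈ p.primeFactors, (1 + 1 / (l : ℝ)))⁻¹ := by
    have := hasProd_prod_of_ne_finset_one (L := .unconditional _)
      (s := p.primeFactors.preimage (fun l : Nat.Primes => (l : ℕ))
        Nat.Primes.coe_nat_injective.injOn)
      (f := fun l : Nat.Primes => if (l : ℕ) ∣ p then (1 + 1 / (l : ℝ))⁻¹ else 1) ?_
    · have h := Finset.prod_preimage (fun l : Nat.Primes => (l : ℕ)) p.primeFactors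
        Nat.Primes.coe_nat_injective.injOn (fun l : ℕ => if l ∣ p then (1 + 1 / (l : ℝ))⁻¹ else 1)
        fun l hl h => absurd ⟨⟨l, Nat.prime_of_mem_primeFactors hl⟩, rfl⟩ h
      rw [← Finset.prod_inv_distrib, ← Finset.prod_congr rfl fun l hl =>
        if_pos (c := l ∣ p) (e := (1 : ℝ)) (Nat.dvd_of_mem_primeFactors hl), ← h]
      exact this
    · intro l hl
      rw [if_neg]
      exact fun h => hl (Finset.mem_preimage.mpr (Nat.mem_primeFactors.mpr ⟨l.2, h, hp⟩))
  have h4 := h1.mul h2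
  suffices h5 : (∑' d : ℕ, (μ d : ℝ) * (Nat.gcd p d) / d ^ 2) * (π ^ 2 / 6) =
      (∏ l ∈ p.primeFactors, (1 + 1 / (l : ℝ)))⁻¹ by
    rw [← h5]; field_simp
  refine h4.unique (h3.congr_fun fun l => ?_)
  have hl : (2 : ℝ) ≤ l := by exact_mod_cast l.2.two_le
  have : (l : ℝ) ^ 2 - 1 ≠ 0 := by nlinarith
  have : (l : ℝ) + 1 ≠ 0 := by positivity
  have : (l : ℝ) - 1 ≠ 0 := by linarith
  by_cases h : (l : ℕ) ∣ p
  · rw [if_pos h, Nat.gcd_eq_right h]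
    field_simp
    ring
  · rw [if_neg h, Nat.Coprime.gcd_eq_one ((Nat.Prime.coprime_iff_not_dvd l.2).mpr h).symm]
    simp
    field_simp

theorem ncard_dvd_le {S : Set (ℤ × ℤ)} (h0 : (0, 0) ∉ S) {d : ℕ} (hd : d ≠ 0) {R : ℝ}
    (hS : ∀ x ∈ S, |(x.1 : ℝ)| ≤ R ∧ |(x.2 : ℝ)| ≤ R ∧ (d : ℤ) ∣ x.1 ∧ (d : ℤ) ∣ x.2) :
    S.Finite ∧ (S.ncard : ℝ) ≤ 9 * (R / d) ^ 2 := by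
  have hd0 : (0 : ℝ) < d := by positivity
  set n : ℕ := ⌊R / d⌋₊ with hn
  have hbound {a : ℤ} (ha : |((d * a : ℤ) : ℝ)| ≤ R) : a ∈ Finset.Icc (-n : ℤ) n := by
    have h1 : (a.natAbs : ℝ) ≤ R / d := by
      rw [le_div_iff₀ hd0, Nat.cast_natAbs, Int.cast_abs]
      push_cast at ha
      rw [abs_mul, Nat.abs_cast] at ha
      linarith
    have h2 : a.natAbs ≤ n := Nat.le_floor h1
    rw [Finset.mem_Icc]
    omega
  have hsub : S ⊆ ((Finset.Icc (-n : ℤ) n ×ˢ Finset.Icc (-n : ℤ) n).image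
      fun y => ((d : ℤ) * y.1, (d : ℤ) * y.2) : Finset (ℤ × ℤ)) := by
    rintro ⟨x, y⟩ hx
    obtain ⟨h1, h2, ⟨a, rfl⟩, ⟨b, rfl⟩⟩ := hS _ hx
    rw [Finset.mem_coe, Finset.mem_image]
    exact ⟨(a, b), Finset.mem_product.mpr ⟨hbound h1, hbound h2⟩, rfl⟩
  refine ⟨(Finset.finite_toSet _).subset hsub, ?_⟩
  rcases Nat.eq_zero_or_pos n with h | h
  · have : S = ∅ := by
      rw [Set.eq_empty_iff_forall_notMem]
      intro x hx
      have := hsub hx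
      rw [h] at this
      simp at this
      exact h0 (this ▸ hx)
    rw [this, Set.ncard_empty, Nat.cast_zero]
    positivity
  · have h1 : S.ncard ≤ (2 * n + 1) ^ 2 := by
      refine (Set.ncard_le_ncard hsub (Finset.finite_toSet _)).trans ?_
      rw [Set.ncard_coe_finset]
      refine Finset.card_image_le.trans ?_
      rw [Finset.card_product, Int.card_Icc, sq]
      exact le_of_eq (by congr 1 <;> omega)
    have hR : 0 ≤ R / d := by
      by_contra hneg
      rw [Nat.floor_of_nonpos (not_le.mp hneg).le] at hn
      omega
    have h2 : (n : ℝ) ≤ R / d := Nat.floor_le hR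
    have h3 : (1 : ℝ) ≤ n := by exact_mod_cast h
    calc (S.ncard : ℝ) ≤ ((2 * n + 1 : ℕ) : ℝ) ^ 2 := by exact_mod_cast h1
      _ ≤ (3 * n) ^ 2 := by push_cast; gcongr; linarith
      _ = 9 * (n : ℝ) ^ 2 := by ring
      _ ≤ 9 * (R / d) ^ 2 := by gcongr

theorem sectorPoints_bounded {ε : ℝ} (hε : 1 < ε) {α β γ δ : ℝ}
    (hdet : α * δ - β * γ ≠ 0) :
    ∃ r : ℝ, 0 ≤ r ∧ ∀ s : ℝ, ∀ x ∈ sectorPoints ε α β γ δ s,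
      |(x.1 : ℝ)| ≤ r * √s ∧ |(x.2 : ℝ)| ≤ r * √s := by
  have h0 : 0 < ε := by linarith
  refine ⟨ε * (|α| + |β| + |γ| + |δ|) / |α * δ - β * γ|, by positivity, ?_⟩
  rintro s ⟨x, y⟩ ⟨⟨h1, h2, h3⟩, h4⟩
  simp only at h1 h2 h3 h4
  set u : ℝ := α * x + β * y with hu
  set w : ℝ := γ * x + δ * y with hw
  have hw0 : 0 < w := h1.trans_le h2
  have hs : 0 < s := (mul_pos h1 hw0).trans_le h4
  have hwb : w ≤ ε * √s := by
    rw [← Real.sqrt_sq h0.le, ← Real.sqrt_mul (sq_nonneg _)]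
    refine Real.le_sqrt_of_sq_le ?_
    nlinarith
  have hwa : |w| ≤ ε * √s := by rwa [abs_of_pos hw0]
  have hua : |u| ≤ ε * √s := by rw [abs_of_pos h1]; linarith
  have hx : (α * δ - β * γ) * x = δ * u - β * w := by rw [hu, hw]; ring
  have hy : (α * δ - β * γ) * y = α * w - γ * u := by rw [hu, hw]; ring
  have hdet' : 0 < |α * δ - β * γ| := abs_pos.mpr hdet
  have hes : 0 ≤ ε * √s := by positivity
  constructor
  · rw [div_mul_eq_mul_div, le_div_iff₀ hdet', mul_comm, ← abs_mul, hx]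
    calc |δ * u - β * w| ≤ |δ * u| + |β * w| := abs_sub _ _
      _ = |δ| * |u| + |β| * |w| := by rw [abs_mul, abs_mul]
      _ ≤ |δ| * (ε * √s) + |β| * (ε * √s) := by gcongr
      _ ≤ _ := by nlinarith [mul_nonneg (abs_nonneg α) hes, mul_nonneg (abs_nonneg γ) hes]
  · rw [div_mul_eq_mul_div, le_div_iff₀ hdet', mul_comm, ← abs_mul, hy]
    calc |α * w - γ * u| ≤ |α * w| + |γ * u| := abs_sub _ _
      _ = |α| * |w| + |γ| * |u| := by rw [abs_mul, abs_mul]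
      _ ≤ |α| * (ε * √s) + |γ| * (ε * √s) := by gcongr
      _ ≤ _ := by nlinarith [mul_nonneg (abs_nonneg δ) hes, mul_nonneg (abs_nonneg β) hes]

theorem zero_notMem_sectorPoints (ε α β γ δ s : ℝ) : (0, 0) ∉ sectorPoints ε α β γ δ s := by
  rintro ⟨⟨h, -⟩, -⟩
  simp at h

open ArithmeticFunction ArithmeticFunction.Moebius in
theorem ncard_coprime_eq_tsum {S : Set (ℤ × ℤ)} (hS : S.Finite) (h0 : (0, 0) ∉ S) :
    ({x ∈ S | IsCoprime x.1 x.2}.ncard : ℝ) =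
      ∑' d : ℕ, (μ d : ℝ) * ({x ∈ S | (d : ℤ) ∣ x.1 ∧ (d : ℤ) ∣ x.2}.ncard : ℝ) := by
  classical
  lift S to Finset (ℤ × ℤ) using hS
  have hc (P : ℤ × ℤ → Prop) [DecidablePred P] :
      ({x ∈ (S : Set (ℤ × ℤ)) | P x}.ncard : ℝ) = ∑ x ∈ S, if P x then (1 : ℝ) else 0 := by
    rw [show {x ∈ (S : Set (ℤ × ℤ)) | P x} = ((S.filter P : Finset _) : Set (ℤ × ℤ)) by
      ext; simp, Set.ncard_coe_finset, Finset.sum_boole]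
  have hdvd (x : ℤ × ℤ) (d : ℕ) : ((d : ℤ) ∣ x.1 ∧ (d : ℤ) ∣ x.2) ↔ d ∣ Int.gcd x.1 x.2 := by
    rw [← Int.natCast_dvd_natCast, Int.dvd_coe_gcd_iff]
  have hne {x : ℤ × ℤ} (hx : x ∈ S) : Int.gcd x.1 x.2 ≠ 0 := by
    intro h
    rw [Int.gcd_eq_zero_iff] at h
    obtain ⟨a, b⟩ := x
    obtain ⟨rfl, rfl⟩ := h
    exact h0 hx
  have hmem {x : ℤ × ℤ} (hx : x ∈ S) {d : ℕ} (hd : d ∉ (Int.gcd x.1 x.2).divisors) :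
      (μ d : ℝ) * (if (d : ℤ) ∣ x.1 ∧ (d : ℤ) ∣ x.2 then (1 : ℝ) else 0) = 0 := by
    rw [Nat.mem_divisors, not_and_not_right] at hd
    rw [if_neg, mul_zero]
    exact fun h => hne hx (hd ((hdvd x d).mp h))
  rw [hc]
  simp_rw [hc, Finset.mul_sum]
  rw [Summable.tsum_finsetSum fun x hx => summable_of_ne_finset_zero fun d hd => hmem hx hd]
  refine Finset.sum_congr rfl fun x hx => ?_
  rw [tsum_eq_sum fun d hd => hmem hx hd]
  have h1 : ∑ d ∈ (Int.gcd x.1 x.2).divisors,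
      (μ d : ℝ) * (if (d : ℤ) ∣ x.1 ∧ (d : ℤ) ∣ x.2 then (1 : ℝ) else 0) =
      ∑ d ∈ (Int.gcd x.1 x.2).divisors, (μ d : ℝ) := by
    refine Finset.sum_congr rfl fun d hd => ?_
    rw [if_pos ((hdvd x d).mpr (Nat.dvd_of_mem_divisors hd)), mul_one]
  rw [h1]
  have h2 := congrArg (fun f : ArithmeticFunction ℤ => (f (Int.gcd x.1 x.2) : ℝ))
    moebius_mul_coe_zeta
  simp only [coe_mul_zeta_apply, one_apply] at h2
  push_cast at h2
  rw [h2]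
  simp only [Int.isCoprime_iff_gcd_eq_one]

open ArithmeticFunction ArithmeticFunction.Moebius Filter Topology in
theorem tendsto_ncard_coprime_sectorPoints {ε : ℝ} (hε : 1 < ε) {α β γ δ : ℝ}
    (hdet : α * δ - β * γ ≠ 0) {p : ℕ} (hp : p ≠ 0) :
    Tendsto (fun s : ℝ => ({x ∈ sectorPoints ε α β γ δ s |
        (p : ℤ) ∣ x.2 ∧ IsCoprime x.1 x.2}.ncard : ℝ) / s) atTop
      (𝓝 (Real.log ε / |α * δ - β * γ| / p *
        (6 / π ^ 2 * (∏ l ∈ p.primeFactors, (1 + 1 / (l : ℝ)))⁻¹))) := by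
  obtain ⟨r, hr0, hr⟩ := sectorPoints_bounded hε hdet
  have hp0 : (0 : ℝ) < p := by positivity
  set P : ℝ → Set (ℤ × ℤ) := sectorPoints ε α β γ δ with hP
  let S : ℝ → Set (ℤ × ℤ) := fun s => {x ∈ P s | (p : ℤ) ∣ x.2}
  let N : ℕ → ℝ → ℝ := fun d s => ({x ∈ S s | (d : ℤ) ∣ x.1 ∧ (d : ℤ) ∣ x.2}.ncard : ℝ)
  have hS0 (s : ℝ) : (0, 0) ∉ S s := fun h => zero_notMem_sectorPoints ε α β γ δ s h.1
  have hSfin (s : ℝ) : (S s).Finite :=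
    (ncard_dvd_le (hS0 s) one_ne_zero (R := r * √s) fun x hx =>
      ⟨(hr s x hx.1).1, (hr s x hx.1).2, by simp, by simp⟩).1
  have hNbound {d : ℕ} (hd : d ≠ 0) {s : ℝ} (hs : 0 < s) :
      N d s / s ≤ 9 * r ^ 2 * (1 / (d : ℝ) ^ 2) := by
    have h := (ncard_dvd_le (S := {x ∈ S s | (d : ℤ) ∣ x.1 ∧ (d : ℤ) ∣ x.2})
      (fun h => hS0 s h.1) hd (R := r * √s)
      fun x hx => ⟨(hr s x hx.1.1).1, (hr s x hx.1.1).2, hx.2⟩).2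
    rw [div_le_iff₀ hs]
    refine h.trans (le_of_eq ?_)
    rw [div_pow, mul_pow, Real.sq_sqrt hs.le]
    ring
  have hNlim {d : ℕ} (hd : d ≠ 0) : Tendsto (fun s => N d s / s) atTop
      (𝓝 (Real.log ε / |α * δ - β * γ| / p * (Nat.gcd p d / d ^ 2))) := by
    set m : ℕ := Nat.lcm d p with hm
    have hd0 : (0 : ℝ) < d := by positivity
    have hm0 : (0 : ℝ) < m := by
      exact_mod_cast Nat.pos_of_ne_zero (Nat.lcm_ne_zero hd hp)
    have hdet' : (α * d) * (δ * m) - (β * m) * (γ * d) = (d * m) * (α * δ - β * γ) := by ring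
    have h := tendsto_ncard_sectorPoints hε (α := α * d) (β := β * m) (γ := γ * d) (δ := δ * m)
      (by rw [hdet']; positivity)
    have hlim : Real.log ε / |(α * d) * (δ * m) - (β * m) * (γ * d)| =
        Real.log ε / |α * δ - β * γ| / p * (Nat.gcd p d / d ^ 2) := by
      have hgm : (Nat.gcd p d : ℝ) * m = p * d := by
        rw [hm, Nat.lcm_comm]
        exact_mod_cast Nat.gcd_mul_lcm p d
      have : |α * δ - β * γ| ≠ 0 := abs_ne_zero.mpr hdet
      rw [hdet', abs_mul, abs_of_pos (mul_pos hd0 hm0)]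
      field_simp
      linear_combination (-Real.log ε) * hgm
    rw [hlim] at h
    refine h.congr fun s => ?_
    congr 2
    refine Set.ncard_congr (fun x _ => ((d : ℤ) * x.1, (m : ℤ) * x.2)) ?_ ?_ ?_
    · rintro ⟨x, y⟩ hx
      refine ⟨⟨?_, ?_⟩, dvd_mul_right _ _, ?_⟩
      · simpa [hP, sectorPoints, mul_assoc] using hx
      · exact Dvd.dvd.mul_right (by exact_mod_cast Nat.dvd_lcm_right d p) _
      · exact Dvd.dvd.mul_right (by exact_mod_cast Nat.dvd_lcm_left d p) _
    · rintro ⟨x, y⟩ ⟨x', y'⟩ _ _ h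
      have h1 : (d : ℤ) ≠ 0 := by exact_mod_cast hd
      have h2 : (m : ℤ) ≠ 0 := by exact_mod_cast hm0.ne'
      simp only [Prod.mk.injEq] at h ⊢
      exact ⟨mul_left_cancel₀ h1 h.1, mul_left_cancel₀ h2 h.2⟩
    · rintro ⟨x, y⟩ ⟨⟨h1, h2⟩, ⟨x', rfl⟩, h4⟩
      have : (m : ℤ) ∣ y := by
        have := Int.coe_lcm_dvd h4 h2
        simpa [hm, Int.lcm] using this
      obtain ⟨y', rfl⟩ := this
      refine ⟨(x', y'), ?_, rfl⟩
      simpa [hP, sectorPoints, mul_assoc] using h1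
  have htsum (s : ℝ) : ({x ∈ P s |
        (p : ℤ) ∣ x.2 ∧ IsCoprime x.1 x.2}.ncard : ℝ) / s = ∑' d : ℕ, (μ d : ℝ) * (N d s / s) := by
    have : {x ∈ P s | (p : ℤ) ∣ x.2 ∧ IsCoprime x.1 x.2} =
        {x ∈ S s | IsCoprime x.1 x.2} := by
      ext x; simp [S, hP, and_assoc]
    rw [this, ncard_coprime_eq_tsum (hSfin s) (hS0 s), ← tsum_div_const]
    simp only [N, mul_div_assoc]
  simp_rw [htsum]
  rw [← tsum_moebius_gcd p hp, ← tsum_mul_left]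
  refine tendsto_tsum_of_dominated_convergence
    (bound := fun d : ℕ => 9 * r ^ 2 * (1 / (d : ℝ) ^ 2)) ?_ ?_ ?_
  · exact (Real.summable_one_div_nat_pow.mpr one_lt_two).mul_left _
  · intro d
    rcases eq_or_ne d 0 with rfl | hd
    · simp
    · convert (hNlim hd).const_mul (μ d : ℝ) using 2
      ring
  · filter_upwards [eventually_gt_atTop 0] with s hs d
    rcases eq_or_ne d 0 with rfl | hd
    · simp
    · have h1 : |(μ d : ℝ)| ≤ 1 := by exact_mod_cast abs_moebius_le_one
      have h2 : 0 ≤ N d s / s := div_nonneg (Nat.cast_nonneg _) hs.le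
      rw [norm_mul, Real.norm_eq_abs, Real.norm_of_nonneg h2]
      calc |(μ d : ℝ)| * (N d s / s) ≤ 1 * (N d s / s) := by gcongr
        _ ≤ _ := by rw [one_mul]; exact hNbound hd hs

end Counting

theorem actPair_mul (g h : SL2Z) (x : ℤ × ℤ) : actPair (g * h) x = actPair g (actPair h x) := by
  simp only [actPair, Matrix.SpecialLinearGroup.coe_mul, Matrix.mul_apply, Fin.sum_univ_two]
  ext <;> simp only <;> ring

theorem actPair_one (x : ℤ × ℤ) : actPair 1 x = x := by
  simp [actPair]

theorem isCoprime_actPair (g : SL2Z) {x : ℤ × ℤ} (hx : IsCoprime x.1 x.2) :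
    IsCoprime (actPair g x).1 (actPair g x).2 := by
  obtain ⟨u, v, h⟩ := hx
  have hdet := g.det_coe
  rw [Matrix.det_fin_two] at hdet
  refine ⟨u * g.1 1 1 - v * g.1 1 0, v * g.1 0 0 - u * g.1 0 1, ?_⟩
  simp only [actPair]
  linear_combination h + (u * x.1 + v * x.2) * hdet

theorem formComp_eq_iff (A B C : ℤ) (g : SL2Z) :
    formComp A B C g = (A, B, C) ↔ ∀ x, Qval A B C (actPair g x) = Qval A B C x := by
  simp only [formComp, Prod.mk.injEq]
  constructor
  · rintro ⟨h1, h2, h3⟩ ⟨x, y⟩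
    simp only [Qval, actPair]
    linear_combination x ^ 2 * h1 + x * y * h2 + y ^ 2 * h3
  · intro h
    have h1 := h (1, 0)
    have h2 := h (0, 1)
    have h3 := h (1, 1)
    simp only [Qval, actPair] at h1 h2 h3
    refine ⟨?_, ?_, ?_⟩
    · linear_combination h1
    · linear_combination h3 - h1 - h2
    · linear_combination h2

/-- The group `SO(Q, ℤ) ∩ Γ₀(p)`. -/
def autGroup (p : ℕ) (A B C : ℤ) : Subgroup SL2Z where
  carrier := {g | formComp A B C g = (A, B, C) ∧ (p : ℤ) ∣ g.1 1 0}
  one_mem' := by simp [formComp]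
  mul_mem' := by
    rintro g h ⟨hg, hpg⟩ ⟨hh, hph⟩
    rw [formComp_eq_iff] at hg hh
    refine ⟨(formComp_eq_iff _ _ _ _).mpr fun x => by rw [actPair_mul, hg, hh], ?_⟩
    rw [Matrix.SpecialLinearGroup.coe_mul, Matrix.mul_apply, Fin.sum_univ_two]
    exact dvd_add (hpg.mul_right _) (hph.mul_left _)
  inv_mem' := by
    rintro g ⟨hg, hpg⟩
    rw [formComp_eq_iff] at hg
    refine ⟨(formComp_eq_iff _ _ _ _).mpr fun x => ?_, ?_⟩
    · rw [← hg, ← actPair_mul, mul_inv_cancel, actPair_one]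
    · rw [Matrix.SpecialLinearGroup.SL2_inv_expl]
      simpa using hpg

theorem dvd_snd_actPair {p : ℕ} {A B C : ℤ} {g : SL2Z} (hg : g ∈ autGroup p A B C) {x : ℤ × ℤ}
    (hx : (p : ℤ) ∣ x.2) : (p : ℤ) ∣ (actPair g x).2 :=
  dvd_add (hg.2.mul_right _) (hx.mul_left _)

/-- The entries of `g` are those of the automorph of `a X² + b X Y + c Y²` attached to a solution
`(t, u)` of Pell's equation `t² - (b² - 4 a c) u² = 4`. -/
def IsAutomorph (a b c t u : ℤ) (g : SL2Z) : Prop :=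
  2 * g.1 0 0 = t - b * u ∧ g.1 0 1 = -(c * u) ∧ g.1 1 0 = a * u ∧ 2 * g.1 1 1 = t + b * u

theorem exists_isAutomorph_of_formComp {k a b c : ℤ} (hk : k ≠ 0) (ha : a ≠ 0)
    (hprim : Int.gcd a (Int.gcd b c) = 1) {g : SL2Z}
    (hg : formComp (k * a) (k * b) (k * c) g = (k * a, k * b, k * c)) :
    ∃ t u : ℤ, t ^ 2 - (b ^ 2 - 4 * a * c) * u ^ 2 = 4 ∧ IsAutomorph a b c t u g := by
  simp only [formComp, Prod.mk.injEq] at hg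
  have hdet := g.det_coe
  rw [Matrix.det_fin_two] at hdet
  obtain ⟨h1, h2, h3⟩ := hg
  unfold IsAutomorph
  generalize g.1 0 0 = m at *
  generalize g.1 0 1 = n at *
  generalize g.1 1 0 = q at *
  generalize g.1 1 1 = r at *
  have h1' : a * m ^ 2 + b * m * q + c * q ^ 2 = a :=
    mul_left_cancel₀ hk (by linear_combination h1)
  have h2' : 2 * a * m * n + b * (m * r + n * q) + 2 * c * q * r = b :=
    mul_left_cancel₀ hk (by linear_combination h2)
  have e1 : a * (r - m) = b * q := by
    refine mul_left_cancel₀ two_ne_zero ?_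
    linear_combination (2 * a * m + 2 * b * q) * hdet - 2 * r * h1' + q * h2' - b * q * hdet
  have e2 : a * n = -(c * q) := by
    refine mul_left_cancel₀ two_ne_zero ?_
    linear_combination m * h2' - 2 * n * h1' - (b * m + 2 * c * q) * hdet
  have hdvd : a ∣ q := by
    have hb : a ∣ b * q := ⟨_, e1.symm⟩
    have hc : a ∣ c * q := ⟨-n, by linear_combination e2⟩
    have h : a ∣ Int.gcd a (Int.gcd b c) * q := by
      rw [Int.gcd_eq_gcd_ab, Int.gcd_eq_gcd_ab b c]
      generalize Int.gcdA a _ = x1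
      generalize Int.gcdB a _ = x2
      generalize Int.gcdA b c = x3
      generalize Int.gcdB b c = x4
      have : (a * x1 + (b * x3 + c * x4) * x2) * q =
        a * (x1 * q) + (b * q) * (x3 * x2) + (c * q) * (x4 * x2) := by ring
      rw [this]
      exact dvd_add (dvd_add (dvd_mul_right _ _) (hb.mul_right _)) (hc.mul_right _)
    rwa [hprim, Nat.cast_one, one_mul] at h
  obtain ⟨u, rfl⟩ := hdvd
  have e1' : r - m = b * u := mul_left_cancel₀ ha (by linear_combination e1)
  have e2' : n = -(c * u) := mul_left_cancel₀ ha (by linear_combination e2)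
  refine ⟨m + r, u, ?_, by linear_combination -e1', e2', rfl, by linear_combination e1'⟩
  have hr : r = m + b * u := by linear_combination e1'
  subst hr e2'
  linear_combination 4 * hdet

theorem exists_isAutomorph {k a b c t u : ℤ} (h : t ^ 2 - (b ^ 2 - 4 * a * c) * u ^ 2 = 4) :
    ∃ g : SL2Z, IsAutomorph a b c t u g ∧
      formComp (k * a) (k * b) (k * c) g = (k * a, k * b, k * c) := by
  have heven : Even (t - b * u) := by
    have h1 : Even ((t - b * u) ^ 2) := by
      refine ⟨2 - 2 * a * c * u ^ 2 + b * u * (b * u - t), ?_⟩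
      linear_combination h
    exact (Int.even_pow.mp h1).1
  obtain ⟨m, hm⟩ := heven
  have ht : t = 2 * m + b * u := by linear_combination hm
  subst ht
  have hdet : m * (m + b * u) - -(c * u) * (a * u) = 1 := by
    refine mul_left_cancel₀ (by norm_num : (4 : ℤ) ≠ 0) ?_
    linear_combination h
  refine ⟨⟨!![m, -(c * u); a * u, m + b * u], by rw [Matrix.det_fin_two_of]; exact hdet⟩, ?_, ?_⟩
  · simp only [IsAutomorph, Matrix.of_apply, Matrix.cons_val', Matrix.cons_val_zero,
      Matrix.cons_val_one, Matrix.cons_val_fin_one]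
    refine ⟨by ring, trivial, trivial, by ring⟩
  · simp only [formComp, Matrix.of_apply, Matrix.cons_val', Matrix.cons_val_zero,
      Matrix.cons_val_one, Matrix.cons_val_fin_one, Prod.mk.injEq]
    refine ⟨?_, ?_, ?_⟩
    · linear_combination k * a * hdet
    · linear_combination k * b * hdet
    · linear_combination k * c * hdet

/-- The linear form `2 a X + (b + e) Y`; for `e = ±√(b² - 4 a c)` these are the two linear factors
of `4 a (a X² + b X Y + c Y²)`. -/
def linFactor (a b : ℤ) (e : ℝ) (x : ℤ × ℤ) : ℝ := 2 * a * x.1 + (b + e) * x.2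

theorem linFactor_mul (a b c : ℤ) {e : ℝ} (he : e ^ 2 = ((b ^ 2 - 4 * a * c : ℤ) : ℝ))
    (x : ℤ × ℤ) :
    linFactor a b e x * linFactor a b (-e) x = 4 * a * (Qval a b c x : ℤ) := by
  simp only [linFactor, Qval]
  push_cast at he ⊢
  linear_combination -(x.2 : ℝ) ^ 2 * he

theorem linFactor_actPair {a b c t u : ℤ} {g : SL2Z} (hg : IsAutomorph a b c t u g) {e : ℝ}
    (he : e ^ 2 = ((b ^ 2 - 4 * a * c : ℤ) : ℝ)) (x : ℤ × ℤ) :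
    linFactor a b e (actPair g x) = (t + u * e) / 2 * linFactor a b e x := by
  obtain ⟨h1, h2, h3, h4⟩ := hg
  have h1' : 2 * (g.1 0 0 : ℝ) = t - b * u := by exact_mod_cast h1
  have h2' : (g.1 0 1 : ℝ) = -(c * u) := by exact_mod_cast h2
  have h3' : (g.1 1 0 : ℝ) = a * u := by exact_mod_cast h3
  have h4' : 2 * (g.1 1 1 : ℝ) = t + b * u := by exact_mod_cast h4
  simp only [linFactor, actPair]
  push_cast at he ⊢
  linear_combination a * x.1 * h1' + 2 * a * x.2 * h2' + (b + e) * x.1 * h3' +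
    (b + e) * x.2 / 2 * h4' - u * x.2 / 2 * he

theorem linFactor_ne_zero {a b c : ℤ} (ha : a ≠ 0) (hnsq : ¬ IsSquare (b ^ 2 - 4 * a * c)) {e : ℝ}
    (he : e ^ 2 = ((b ^ 2 - 4 * a * c : ℤ) : ℝ)) {x : ℤ × ℤ} (hx : x ≠ 0) :
    linFactor a b e x ≠ 0 := by
  intro h
  have h1 : (2 * a * x.1 + b * x.2) ^ 2 = (b ^ 2 - 4 * a * c) * x.2 ^ 2 := by
    have : ((2 * a * x.1 + b * x.2 : ℤ) : ℝ) = -(e * x.2) := by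
      simp only [linFactor] at h
      push_cast
      linear_combination h
    have h2 : ((2 * a * x.1 + b * x.2 : ℤ) : ℝ) ^ 2 =
        ((b ^ 2 - 4 * a * c : ℤ) : ℝ) * (x.2 : ℝ) ^ 2 := by
      rw [this, ← he]; ring
    exact_mod_cast h2
  by_cases hy : x.2 = 0
  · rw [hy] at h1
    have h3 : x.1 = 0 := by simpa [ha] using h1
    exact hx (Prod.ext h3 hy)
  · obtain ⟨m, hm⟩ : x.2 ∣ 2 * a * x.1 + b * x.2 :=
      (Int.pow_dvd_pow_iff two_ne_zero).mp ⟨_, h1.trans (mul_comm _ _)⟩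
    refine hnsq ⟨m, mul_right_cancel₀ (pow_ne_zero 2 hy) ?_⟩
    rw [← h1, hm]; ring

/-- A fundamental domain for the action of the automorphs of `a X² + b X Y + c Y²` on pairs at
which the form does not vanish, where `δ² = b² - 4 a c`. -/
def fundDomain (a b : ℤ) (δ ε : ℝ) : Set (ℤ × ℤ) :=
  {x | 0 < linFactor a b (-δ) x ∧ linFactor a b (-δ) x ≤ |linFactor a b δ x| ∧
    |linFactor a b δ x| < ε ^ 2 * linFactor a b (-δ) x}

theorem actPair_eq_self_of_mem_fundDomain {p : ℕ} {k a b c t₀ u₀ : ℤ} (hk : k ≠ 0) (ha : a ≠ 0)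
    (hprim : Int.gcd a (Int.gcd b c) = 1) (hpa : IsCoprime (p : ℤ) a) {δ : ℝ} (hδ0 : 0 < δ)
    (hδ : δ ^ 2 = ((b ^ 2 - 4 * a * c : ℤ) : ℝ)) (ht₀ : 0 < t₀) (hu₀ : 0 < u₀)
    (h₀ : t₀ ^ 2 - (b ^ 2 - 4 * a * c) * u₀ ^ 2 = 4)
    (hmin : ∀ t u : ℤ, 0 < t → 0 < u → (p : ℤ) ∣ u → t ^ 2 - (b ^ 2 - 4 * a * c) * u ^ 2 = 4 →
      u₀ ≤ u)
    {g : SL2Z} (hg : g ∈ autGroup p (k * a) (k * b) (k * c)) {x : ℤ × ℤ}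
    (hx : x ∈ fundDomain a b δ ((t₀ + u₀ * δ) / 2))
    (hgx : actPair g x ∈ fundDomain a b δ ((t₀ + u₀ * δ) / 2)) : actPair g x = x := by
  obtain ⟨t, u, htu, haut⟩ := exists_isAutomorph_of_formComp hk ha hprim hg.1
  have hpu : (p : ℤ) ∣ u := hpa.dvd_of_dvd_mul_left (haut.2.2.1 ▸ hg.2)
  have hD : (0 : ℤ) < b ^ 2 - 4 * a * c := by
    have : (0 : ℝ) < ((b ^ 2 - 4 * a * c : ℤ) : ℝ) := by rw [← hδ]; positivity
    exact_mod_cast this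
  have hδ' : (-δ) ^ 2 = ((b ^ 2 - 4 * a * c : ℤ) : ℝ) := by rw [neg_sq, hδ]
  obtain ⟨x1, x2, x3⟩ := hx
  obtain ⟨y1, y2, y3⟩ := hgx
  rw [linFactor_actPair haut hδ'] at y1 y2 y3
  rw [linFactor_actPair haut hδ, abs_mul] at y2 y3
  set l : ℝ := (t + u * δ) / 2 with hl
  set m : ℝ := (t + u * -δ) / 2 with hm
  set ε : ℝ := (t₀ + u₀ * δ) / 2 with hε
  have hε0 : 0 < ε := by positivity
  have hm0 : 0 < m := pos_of_mul_pos_left y1 x1.le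
  have hlm : l * m = 1 := by
    have h : (t : ℝ) ^ 2 - ((b ^ 2 - 4 * a * c : ℤ) : ℝ) * u ^ 2 = 4 := by exact_mod_cast htu
    rw [← hδ] at h
    rw [hl, hm]
    linear_combination h / 4
  have hl0 : 0 < l := pos_of_mul_pos_left (hlm ▸ one_pos) hm0.le
  rw [abs_of_pos hl0] at y2 y3
  have hy : 0 < |linFactor a b δ x| := x1.trans_le x2
  have hlε : l < ε := by
    refine lt_of_pow_lt_pow_left₀ 2 hε0.le (lt_of_mul_lt_mul_right ?_ hy.le)
    calc l ^ 2 * |linFactor a b δ x| = l * (l * |linFactor a b δ x|) := by ring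
      _ < l * (ε ^ 2 * (m * linFactor a b (-δ) x)) := by gcongr
      _ = ε ^ 2 * linFactor a b (-δ) x := by linear_combination ε ^ 2 * linFactor a b (-δ) x * hlm
      _ ≤ ε ^ 2 * |linFactor a b δ x| := by gcongr
  have hmε : m < ε := by
    refine lt_of_pow_lt_pow_left₀ 2 hε0.le (lt_of_mul_lt_mul_right ?_ x1.le)
    calc m ^ 2 * linFactor a b (-δ) x = m * (m * linFactor a b (-δ) x) := by ring
      _ ≤ m * (l * |linFactor a b δ x|) := by gcongr
      _ = |linFactor a b δ x| := by linear_combination |linFactor a b δ x| * hlm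
      _ < ε ^ 2 * linFactor a b (-δ) x := x3
  have ht : 0 < t := by
    have : (0 : ℝ) < t := by
      have : (t : ℝ) = l + m := by rw [hl, hm]; ring
      rw [this]; positivity
    exact_mod_cast this
  have hle {v : ℤ} (hv : 0 < v) (hpv : (p : ℤ) ∣ v)
      (htv : t ^ 2 - (b ^ 2 - 4 * a * c) * v ^ 2 = 4) : ε ≤ (t + v * δ) / 2 := by
    have h1 := hmin t v ht hv hpv htv
    have h2 : t₀ ≤ t := by
      refine le_of_sq_le_sq ?_ ht.le
      nlinarith [mul_le_mul_of_nonneg_left (pow_le_pow_left₀ hu₀.le h1 2) hD.le]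
    have h1' : (u₀ : ℝ) ≤ v := by exact_mod_cast h1
    have h2' : (t₀ : ℝ) ≤ t := by exact_mod_cast h2
    rw [hε]
    gcongr
  have hu : u = 0 := by
    rcases lt_trichotomy u 0 with hu | hu | hu
    · have := hle (neg_pos.mpr hu) (hpu.neg_right) (by rw [neg_sq, htu])
      push_cast at this
      exact absurd (this.trans_eq (by rw [hm]; ring)) hmε.not_ge
    · exact hu
    · exact absurd (hle hu hpu htu) hlε.not_ge
  subst hu
  have ht2 : t = 2 := by nlinarith
  subst ht2
  obtain ⟨h1, h2, h3, h4⟩ := haut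
  ext
  · simp only [actPair, h2]
    rw [show g.1 0 0 = 1 by linarith]
    ring
  · simp only [actPair, h3]
    rw [show g.1 1 1 = 1 by linarith]
    ring

theorem zpow_actPair {f : ℤ × ℤ → ℝ} {g : SL2Z} {l : ℝ} (hl : l ≠ 0)
    (h : ∀ x, f (actPair g x) = l * f x) (n : ℤ) (x : ℤ × ℤ) :
    f (actPair (g ^ n) x) = l ^ n * f x := by
  induction n generalizing x with
  | zero => simp [actPair_one]
  | succ n ih => rw [zpow_add_one, actPair_mul, ih, h, zpow_add_one₀ hl, mul_assoc]
  | pred n ih =>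
    have h' : f (actPair g⁻¹ x) = l⁻¹ * f x := by
      rw [eq_inv_mul_iff_mul_eq₀ hl, ← h, ← actPair_mul, mul_inv_cancel, actPair_one]
    rw [zpow_sub_one, actPair_mul, ih, h', zpow_sub_one₀ hl, mul_assoc]

theorem exists_actPair_mem_fundDomain {p : ℕ} {k a b c t₀ u₀ : ℤ} (ha : a ≠ 0)
    (hnsq : ¬ IsSquare (b ^ 2 - 4 * a * c)) {δ : ℝ} (hδ0 : 0 < δ)
    (hδ : δ ^ 2 = ((b ^ 2 - 4 * a * c : ℤ) : ℝ)) (ht₀ : 0 < t₀) (hu₀ : 0 < u₀)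
    (hpu : (p : ℤ) ∣ u₀) (h₀ : t₀ ^ 2 - (b ^ 2 - 4 * a * c) * u₀ ^ 2 = 4)
    {x : ℤ × ℤ} (hx : x ≠ 0) :
    ∃ g ∈ autGroup p (k * a) (k * b) (k * c),
      actPair g x ∈ fundDomain a b δ ((t₀ + u₀ * δ) / 2) := by
  have hδ' : (-δ) ^ 2 = ((b ^ 2 - 4 * a * c : ℤ) : ℝ) := by rw [neg_sq, hδ]
  wlog hpos : 0 < linFactor a b (-δ) x generalizing x with H
  · obtain ⟨g, hg1, hg2⟩ := exists_isAutomorph (k := k) (a := a) (b := b) (c := c) (t := -2)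
      (u := 0) (by norm_num)
    have hgm : g ∈ autGroup p (k * a) (k * b) (k * c) := ⟨hg2, by rw [hg1.2.2.1]; simp⟩
    have hneg : 0 < linFactor a b (-δ) (actPair g x) := by
      rw [linFactor_actPair hg1 hδ']
      have := lt_of_le_of_ne (not_lt.mp hpos) (linFactor_ne_zero ha hnsq hδ' hx)
      push_cast
      linarith
    have hne : actPair g x ≠ 0 := by
      intro h
      rw [h] at hneg
      simp [linFactor] at hneg
    obtain ⟨g', hg', hm⟩ := H hne hneg
    exact ⟨g' * g, mul_mem hg' hgm, by rwa [actPair_mul]⟩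
  obtain ⟨g, hg1, hg2⟩ := exists_isAutomorph (k := k) h₀
  have hgm : g ∈ autGroup p (k * a) (k * b) (k * c) :=
    ⟨hg2, by rw [hg1.2.2.1]; exact hpu.mul_left _⟩
  set ε : ℝ := (t₀ + u₀ * δ) / 2 with hε
  have hprod : ε * ((t₀ + u₀ * -δ) / 2) = 1 := by
    have h : (t₀ : ℝ) ^ 2 - ((b ^ 2 - 4 * a * c : ℤ) : ℝ) * u₀ ^ 2 = 4 := by exact_mod_cast h₀
    rw [← hδ] at h
    rw [hε]
    linear_combination h / 4
  have hε0 : 0 < ε := by positivity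
  have hε1 : 1 < ε := by
    have : (t₀ + u₀ * -δ) / 2 < ε := by
      rw [hε]
      have : 0 < u₀ * δ := by positivity
      linarith
    nlinarith
  obtain ⟨n, hn1, hn2⟩ := exists_mem_Ico_zpow (x := |linFactor a b δ x| / linFactor a b (-δ) x)
    (y := ε ^ 2) (div_pos (abs_pos.mpr (linFactor_ne_zero ha hnsq hδ hx)) hpos)
    (one_lt_pow₀ hε1 two_ne_zero)
  rw [le_div_iff₀ hpos] at hn1
  rw [div_lt_iff₀ hpos] at hn2
  have hf1 := zpow_actPair hε0.ne' (linFactor_actPair hg1 hδ) (-n) x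
  have hf2 := zpow_actPair (f := linFactor a b (-δ)) (g := g) (inv_ne_zero hε0.ne') (fun x => by
    rw [linFactor_actPair hg1 hδ', eq_inv_of_mul_eq_one_right hprod]) (-n) x
  rw [inv_zpow', neg_neg] at hf2
  have hεn : 0 < ε ^ n := zpow_pos hε0 n
  have hsq : (ε ^ 2) ^ n = ε ^ n * ε ^ n := by rw [sq, mul_zpow]
  refine ⟨g ^ (-n), zpow_mem hgm _, ?_⟩
  simp only [fundDomain, Set.mem_ofPred_eq]
  rw [hf1, hf2, abs_mul, zpow_neg, abs_of_pos (inv_pos.mpr hεn)]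
  refine ⟨by positivity, ?_, ?_⟩
  · rw [le_inv_mul_iff₀ hεn]
    calc _ = (ε ^ 2) ^ n * linFactor a b (-δ) x := by rw [hsq]; ring
      _ ≤ _ := hn1
  · rw [inv_mul_lt_iff₀ hεn]
    calc _ < _ := hn2
      _ = _ := by rw [zpow_add_one₀ (by positivity), hsq]; ring

theorem PsiP0_eq_ncard {p : ℕ} {A B C : ℤ} {W : Set (ℤ × ℤ)}
    (hex : ∀ x : ℤ × ℤ, x ≠ 0 → ∃ g ∈ autGroup p A B C, actPair g x ∈ W)
    (huniq : ∀ g ∈ autGroup p A B C, ∀ x ∈ W, actPair g x ∈ W → actPair g x = x) (s : ℝ) :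
    PsiP0 p A B C s = {x : ℤ × ℤ | x ∈ W ∧ ((|Qval A B C x| : ℤ) : ℝ) ≤ s ∧
      (p : ℤ) ∣ x.2 ∧ IsCoprime x.1 x.2}.ncard := by
  set r := fun x y : {x : ℤ × ℤ // IsCoprime x.1 x.2 ∧ (p : ℤ) ∣ x.2 ∧
    ((|Qval A B C x| : ℤ) : ℝ) ≤ s} => ∃ g : SL2Z, formComp A B C g = (A, B, C) ∧
      (p : ℤ) ∣ g.1 1 0 ∧ (y : ℤ × ℤ) = actPair g (x : ℤ × ℤ) with hr
  have hequiv : Equivalence r := by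
    have hG {g : SL2Z} (hg : g ∈ autGroup p A B C) : formComp A B C g = (A, B, C) ∧
      (p : ℤ) ∣ g.1 1 0 := hg
    refine ⟨fun x => ?_, ?_, ?_⟩
    · exact ⟨1, (hG (one_mem _)).1, (hG (one_mem _)).2, (actPair_one _).symm⟩
    · rintro x y ⟨g, hg1, hg2, hg⟩
      have hg' : g⁻¹ ∈ autGroup p A B C := inv_mem ⟨hg1, hg2⟩
      exact ⟨g⁻¹, hg'.1, hg'.2, by rw [hg, ← actPair_mul, inv_mul_cancel, actPair_one]⟩
    · rintro x y z ⟨g, hg1, hg2, hg⟩ ⟨h, hh1, hh2, hh⟩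
      have hgh : h * g ∈ autGroup p A B C := mul_mem ⟨hh1, hh2⟩ ⟨hg1, hg2⟩
      exact ⟨h * g, hgh.1, hgh.2, by rw [hh, hg, actPair_mul]⟩
  rw [← Nat.card_coe_set_eq]
  refine (Nat.card_congr (Equiv.ofBijective (fun x : {x : ℤ × ℤ | x ∈ W ∧
    ((|Qval A B C x| : ℤ) : ℝ) ≤ s ∧ (p : ℤ) ∣ x.2 ∧ IsCoprime x.1 x.2} =>
      Quot.mk r ⟨x.1, x.2.2.2.2, x.2.2.2.1, x.2.2.1⟩) ⟨?_, ?_⟩)).symm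
  · rintro ⟨x, hx⟩ ⟨y, hy⟩ h
    obtain ⟨g, hg1, hg2, hg⟩ := (hequiv.quot_mk_eq_iff _ _).mp h
    simp only at hg
    subst hg
    exact Subtype.ext (huniq g ⟨hg1, hg2⟩ x hx.1 hy.1).symm
  · rintro ⟨x, hx1, hx2, hx3⟩
    have hx0 : x ≠ 0 := by
      rintro rfl
      exact not_isCoprime_zero_zero hx1
    obtain ⟨g, hg, hgW⟩ := hex x hx0
    have hQ := (formComp_eq_iff A B C g).mp hg.1 x
    exact ⟨⟨actPair g x, hgW, by rwa [hQ], dvd_snd_actPair hg hx2, isCoprime_actPair g hx1⟩,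
      (hequiv.quot_mk_eq_iff _ _).mpr (hequiv.symm ⟨g, hg.1, hg.2, rfl⟩)⟩

theorem finite_sectorPoints {ε : ℝ} (hε : 1 < ε) {α β γ δ : ℝ} (hdet : α * δ - β * γ ≠ 0) (s : ℝ) :
    (sectorPoints ε α β γ δ s).Finite := by
  obtain ⟨r, -, hr⟩ := sectorPoints_bounded hε hdet
  exact (ncard_dvd_le (zero_notMem_sectorPoints ε α β γ δ s) one_ne_zero fun x hx =>
    ⟨(hr s x hx).1, (hr s x hx).2, by simp, by simp⟩).1

theorem ncard_fundDomain {k a b c : ℤ} (hk : 0 < k) (ha : a ≠ 0) {δ ε : ℝ} (hδ0 : 0 < δ)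
    (hδ : δ ^ 2 = ((b ^ 2 - 4 * a * c : ℤ) : ℝ)) (hε : 1 < ε) (P : ℤ × ℤ → Prop) (s : ℝ) :
    {x : ℤ × ℤ | x ∈ fundDomain a b δ ε ∧
        ((|Qval (k * a) (k * b) (k * c) x| : ℤ) : ℝ) ≤ s ∧ P x}.ncard =
      {x ∈ sectorPoints ε (2 * a) (b - δ) (2 * a) (b + δ) (4 * |(a : ℝ)| / k * s) | P x}.ncard +
      {x ∈ sectorPoints ε (2 * a) (b - δ) (-(2 * a)) (-(b + δ)) (4 * |(a : ℝ)| / k * s) |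
        P x}.ncard := by
  have ha' : (a : ℝ) ≠ 0 := by exact_mod_cast ha
  have hk' : (0 : ℝ) < k := by exact_mod_cast hk
  have hQ (x : ℤ × ℤ) : ((|Qval (k * a) (k * b) (k * c) x| : ℤ) : ℝ) ≤ s ↔
      |linFactor a b δ x| * |linFactor a b (-δ) x| ≤ 4 * |(a : ℝ)| / k * s := by
    have h1 : Qval (k * a) (k * b) (k * c) x = k * Qval a b c x := by simp only [Qval]; ring
    rw [← abs_mul, linFactor_mul a b c hδ, h1, Int.cast_abs, Int.cast_mul, abs_mul, abs_mul,
      abs_mul, abs_of_pos hk', div_mul_eq_mul_div, le_div_iff₀ hk', abs_of_pos (four_pos (α := ℝ))]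
    have h4 : 0 < 4 * |(a : ℝ)| := by positivity
    rw [← mul_le_mul_iff_right₀ h4]
    ring_nf
  rw [← Set.ncard_union_eq ?_ ?_ ?_]
  · congr 1
    ext x
    have e1 : (2 * a * x.1 + (b - δ) * x.2 : ℝ) = linFactor a b (-δ) x := by
      simp only [linFactor]; ring
    have e2 : (-(2 * a) * x.1 + -(b + δ) * x.2 : ℝ) = -linFactor a b δ x := by
      simp only [linFactor]; ring
    simp only [Set.mem_union, Set.mem_ofPred_eq, sectorPoints, sector, fundDomain, hQ, e1, e2]
    rw [← linFactor]
    generalize linFactor a b δ x = l at *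
    generalize linFactor a b (-δ) x = m at *
    constructor
    · rintro ⟨⟨h1, h2, h3⟩, h4, h5⟩
      rw [abs_of_pos h1] at h4
      rcases abs_cases l with ⟨hl, -⟩ | ⟨hl, -⟩
      · rw [hl] at h2 h3 h4
        exact Or.inl ⟨⟨⟨h1, h2, h3⟩, by linarith⟩, h5⟩
      · rw [hl] at h2 h3 h4
        exact Or.inr ⟨⟨⟨h1, h2, h3⟩, by linarith⟩, h5⟩
    · rintro (⟨⟨⟨h1, h2, h3⟩, h4⟩, h5⟩ | ⟨⟨⟨h1, h2, h3⟩, h4⟩, h5⟩)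
      · rw [abs_of_pos h1, abs_of_pos (h1.trans_le h2)]
        exact ⟨⟨h1, h2, h3⟩, by linarith, h5⟩
      · rw [abs_of_pos h1, abs_of_neg (neg_pos.mp (h1.trans_le h2))]
        exact ⟨⟨h1, h2, h3⟩, by linarith, h5⟩
  · rw [Set.disjoint_left]
    rintro x ⟨⟨⟨h1, h2, -⟩, -⟩, -⟩ ⟨⟨⟨-, h3, -⟩, -⟩, -⟩
    simp only at h1 h2 h3
    linarith
  · refine (finite_sectorPoints hε ?_ _).subset (Set.sep_subset _ _)
    rw [show (2 * a * (b + δ) - (b - δ) * (2 * a) : ℝ) = 4 * a * δ by ring]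
    positivity
  · refine (finite_sectorPoints hε ?_ _).subset (Set.sep_subset _ _)
    rw [show (2 * a * -(b + δ) - (b - δ) * -(2 * a) : ℝ) = -(4 * a * δ) by ring]
    exact neg_ne_zero.mpr (by positivity)

open Filter Topology in
theorem tendsto_ncard_fundDomain {k a b c : ℤ} (hk : 0 < k) (ha : a ≠ 0) {δ ε : ℝ} (hδ0 : 0 < δ)
    (hδ : δ ^ 2 = ((b ^ 2 - 4 * a * c : ℤ) : ℝ)) (hε : 1 < ε) {p : ℕ} (hp : p ≠ 0) :
    Tendsto (fun s : ℝ => ({x : ℤ × ℤ | x ∈ fundDomain a b δ ε ∧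
        ((|Qval (k * a) (k * b) (k * c) x| : ℤ) : ℝ) ≤ s ∧
        (p : ℤ) ∣ x.2 ∧ IsCoprime x.1 x.2}.ncard : ℝ) / s) atTop
      (𝓝 (12 * Real.log ε / (π ^ 2 * p * (k * δ)) *
        (∏ l ∈ p.primeFactors, (1 + 1 / (l : ℝ)))⁻¹)) := by
  have ha' : (a : ℝ) ≠ 0 := by exact_mod_cast ha
  have hk' : (0 : ℝ) < k := by exact_mod_cast hk
  have hd1 : (2 * a * (b + δ) - (b - δ) * (2 * a) : ℝ) = 4 * a * δ := by ring
  have hd2 : (2 * a * -(b + δ) - (b - δ) * -(2 * a) : ℝ) = -(4 * a * δ) := by ring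
  have h0 : 4 * a * δ ≠ 0 := by positivity
  have hc : 0 < 4 * |(a : ℝ)| / k := by positivity
  have hlim : Tendsto (fun s : ℝ => 4 * |(a : ℝ)| / k * s) atTop atTop :=
    tendsto_id.const_mul_atTop hc
  have H1 := (tendsto_ncard_coprime_sectorPoints hε (hd1 ▸ h0) hp).comp hlim
  have H2 := (tendsto_ncard_coprime_sectorPoints hε (hd2 ▸ neg_ne_zero.mpr h0) hp).comp hlim
  rw [hd1] at H1
  rw [hd2, abs_neg] at H2
  have H := (H1.add H2).const_mul (4 * |(a : ℝ)| / k)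
  have hval : 4 * |(a : ℝ)| / k * (Real.log ε / |4 * a * δ| / p *
      (6 / π ^ 2 * (∏ l ∈ p.primeFactors, (1 + 1 / (l : ℝ)))⁻¹) + Real.log ε / |4 * a * δ| / p *
      (6 / π ^ 2 * (∏ l ∈ p.primeFactors, (1 + 1 / (l : ℝ)))⁻¹)) =
      12 * Real.log ε / (π ^ 2 * p * (k * δ)) *
        (∏ l ∈ p.primeFactors, (1 + 1 / (l : ℝ)))⁻¹ := by
    rw [abs_mul, abs_mul, abs_of_pos (four_pos (α := ℝ)), abs_of_pos hδ0]
    have : |(a : ℝ)| ≠ 0 := abs_ne_zero.mpr ha'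
    have : (p : ℝ) ≠ 0 := by exact_mod_cast hp
    generalize (∏ l ∈ p.primeFactors, (1 + 1 / (l : ℝ)))⁻¹ = q
    field_simp
    ring
  rw [← hval]
  refine H.congr fun s => ?_
  rw [ncard_fundDomain hk ha hδ0 hδ hε, Nat.cast_add]
  simp only [Function.comp_apply]
  rw [← add_div, ← mul_div_assoc, mul_div_mul_left _ _ hc.ne']

/-- Let `p ≥ 2` and `Q = A X² + B X Y + C Y²` an indefinite integral binary quadratic form
with non-square discriminant `D_Q` and `A ≡ 1 mod p`; `D'` the quotient of `D_Q` by the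
square of the gcd of the coefficients, `(t_{Q,p}, u_{Q,p})` the solution of `t² - D' u² = 4`
with `t, u > 0`, `p ∣ u`, `u` minimal, and `R_{Q,p} = log ((t_{Q,p} + u_{Q,p} √D')/2)`. Then,
as `s → +∞`,
`Ψ_{Q,p,0}(s) ∼ (12 R_{Q,p} / (π² p √D_Q)) (∏_{𝔭 | p} (1 + 1/𝔭))⁻¹ s`. -/
theorem stmt15 (p : ℕ) (hp : 2 ≤ p) (A B C : ℤ) (hindef : 0 < B ^ 2 - 4 * A * C)
    (hnsq : ¬ IsSquare (B ^ 2 - 4 * A * C)) (hA : (p : ℤ) ∣ A - 1)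
    (D' : ℤ) (hD' : B ^ 2 - 4 * A * C = D' * (Int.gcd A (Int.gcd B C) : ℤ) ^ 2)
    (tQ uQ : ℤ) (htQ : 0 < tQ) (huQ : 0 < uQ) (hpu : (p : ℤ) ∣ uQ)
    (hPell : tQ ^ 2 - D' * uQ ^ 2 = 4)
    (hmin : ∀ t u : ℤ, 0 < t → 0 < u → (p : ℤ) ∣ u → t ^ 2 - D' * u ^ 2 = 4 → uQ ≤ u) :
    Asymptotics.IsEquivalent Filter.atTop
      (fun s : ℝ => (PsiP0 p A B C s : ℝ))
      (fun s : ℝ =>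
        12 * Real.log (((tQ : ℝ) + (uQ : ℝ) * Real.sqrt ((D' : ℝ))) / 2) /
          (π ^ 2 * (p : ℝ) * Real.sqrt ((B ^ 2 - 4 * A * C : ℤ) : ℝ)) *
          (∏ l ∈ p.primeFactors, (1 + 1 / (l : ℝ)))⁻¹ * s) := by
  obtain ⟨k, hk⟩ : ∃ k : ℕ, Int.gcd A (Int.gcd B C) = k := ⟨_, rfl⟩
  have hk0 : k ≠ 0 := by
    rintro rfl
    rw [hD', hk] at hindef
    simp at hindef
  have hkpos : (0 : ℤ) < k := by positivity
  obtain ⟨a, ha⟩ : (k : ℤ) ∣ A := hk ▸ Int.gcd_dvd_left _ _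
  have hBC : (k : ℤ) ∣ (Int.gcd B C : ℤ) := hk ▸ Int.gcd_dvd_right _ _
  obtain ⟨b, hb⟩ : (k : ℤ) ∣ B := hBC.trans (Int.gcd_dvd_left _ _)
  obtain ⟨c, hc⟩ : (k : ℤ) ∣ C := hBC.trans (Int.gcd_dvd_right _ _)
  rw [hk] at hD'
  subst ha hb hc
  have hprim : Int.gcd a (Int.gcd b c) = 1 := by
    rw [Int.gcd_mul_left, Int.natAbs_natCast, Nat.cast_mul, Int.gcd_mul_left,
      Int.natAbs_natCast] at hk
    exact Nat.eq_of_mul_eq_mul_left (Nat.pos_of_ne_zero hk0) (hk.trans (mul_one k).symm)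
  obtain rfl : D' = b ^ 2 - 4 * a * c := by
    refine mul_right_cancel₀ (pow_ne_zero 2 hkpos.ne') ?_
    rw [← hD']
    ring
  have hD : 0 < b ^ 2 - 4 * a * c := by
    rw [hD'] at hindef
    exact pos_of_mul_pos_left hindef (by positivity)
  have hnsq' : ¬ IsSquare (b ^ 2 - 4 * a * c) := fun h =>
    hnsq (hD' ▸ h.mul (IsSquare.sq _))
  have ha0 : a ≠ 0 := by
    rintro rfl
    exact hnsq' ⟨b, by ring⟩
  have hpa : IsCoprime (p : ℤ) a := by
    obtain ⟨m, hm⟩ := hA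
    exact ⟨-m, k, by linear_combination hm⟩
  set δ : ℝ := √((b ^ 2 - 4 * a * c : ℤ) : ℝ) with hδdef
  have hDR : (0 : ℝ) < ((b ^ 2 - 4 * a * c : ℤ) : ℝ) := by exact_mod_cast hD
  have hδ0 : 0 < δ := Real.sqrt_pos.mpr hDR
  have hδ : δ ^ 2 = ((b ^ 2 - 4 * a * c : ℤ) : ℝ) := Real.sq_sqrt hDR.le
  have hε : 1 < ((tQ : ℝ) + uQ * δ) / 2 := by
    have h1 : (2 : ℤ) < tQ := by nlinarith [mul_pos hD (pow_pos huQ 2)]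
    have h1' : (2 : ℝ) < tQ := by exact_mod_cast h1
    have : 0 < uQ * δ := by positivity
    linarith
  have hsqrt : √(((k * b) ^ 2 - 4 * (k * a) * (k * c) : ℤ) : ℝ) = (k : ℤ) * δ := by
    rw [hD', Int.cast_mul, Int.cast_pow, Real.sqrt_mul hDR.le,
      Real.sqrt_sq (by positivity), mul_comm]
  have hp0 : p ≠ 0 := by omega
  have hlim := tendsto_ncard_fundDomain (c := c) hkpos ha0 hδ0 hδ hε hp0
  simp_rw [← PsiP0_eq_ncard
    (fun x hx => exists_actPair_mem_fundDomain (k := k) ha0 hnsq' hδ0 hδ htQ huQ hpu hPell hx)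
    (fun g hg x hx hgx => actPair_eq_self_of_mem_fundDomain hkpos.ne' ha0 hprim hpa hδ0 hδ htQ huQ
      hPell hmin hg hx hgx)] at hlim
  rw [hsqrt]
  have hprod : 0 < ∏ l ∈ p.primeFactors, (1 + 1 / (l : ℝ)) :=
    Finset.prod_pos fun l _ => by positivity
  have hlog := Real.log_pos hε
  set L := 12 * Real.log (((tQ : ℝ) + uQ * δ) / 2) / (π ^ 2 * p * ((k : ℤ) * δ)) *
    (∏ l ∈ p.primeFactors, (1 + 1 / (l : ℝ)))⁻¹ with hL
  have hL0 : L ≠ 0 := by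
    have : (0 : ℝ) < p := by positivity
    have : (0 : ℝ) < (k : ℤ) := by exact_mod_cast hkpos
    positivity
  rw [Asymptotics.isEquivalent_iff_tendsto_one]
  · have h := hlim.div_const L
    rw [div_self hL0] at h
    refine h.congr fun s => ?_
    simp only [Pi.div_apply]
    rw [div_div, mul_comm s]
  · filter_upwards [Filter.eventually_ne_atTop 0] with s hs
    exact mul_ne_zero hL0 hs
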